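/- arXiv:1906.01405 — 2 statements merged into one kernel-verified Lean document; each statement's English description precedes it below -/
import Mathlib

section
/- (Zinn's decoupling inequality.) There exist absolute constants c, C > 0 such that the following holds. Let (Ω, 𝓕, μ) be a probability space, N ∈ ℕ, and for each k = 1,…,N let f_k : Ω^k → ℝ be measurable. Then c · D ≤ ∫_{Ω^N} √(Σ_{k=1}^N |f_k(x₁,…,x_k)|²) dμ^⊗N(x) ≤ C · D, where D = ∫_{Ω^N} ∫_{Ω^N} √(Σ_{k=1}^N |f_k(x₁,…,x_{k−1},y_k)|²) dμ^⊗N(x) dμ^⊗N(y), the integrals being taken in [0,∞]. -/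
open MeasureTheory
open scoped NNReal ENNReal

noncomputable def piMeasure {Ω : Type*} [MeasurableSpace Ω] (μ : Measure Ω) (N : ℕ) :
    Measure (Fin N → Ω) := Measure.pi fun _ => μ

/-- Increments of the square root decrease. -/
lemma sqrt_add_add_add_sqrt_le (u v w : ℝ≥0) :
    NNReal.sqrt (u + v + w) + NNReal.sqrt u ≤ NNReal.sqrt (u + v) + NNReal.sqrt (u + w) := by
  have key : NNReal.sqrt (u + v + w) * NNReal.sqrt u
      ≤ NNReal.sqrt (u + v) * NNReal.sqrt (u + w) := by
    rw [← NNReal.sqrt_mul, ← NNReal.sqrt_mul]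
    refine NNReal.sqrt_le_sqrt.2 ?_
    calc (u + v + w) * u ≤ (u + v + w) * u + v * w := le_self_add
      _ = (u + v) * (u + w) := by ring
  have h₁ := NNReal.sq_sqrt (u + v + w)
  have h₂ := NNReal.sq_sqrt u
  have h₃ := NNReal.sq_sqrt (u + v)
  have h₄ := NNReal.sq_sqrt (u + w)
  refine (sq_le_sq₀ zero_le zero_le).1 ?_
  rw [add_sq, add_sq, h₁, h₂, h₃, h₄]
  calc u + v + w + 2 * NNReal.sqrt (u + v + w) * NNReal.sqrt u + u
      = u + v + (u + w) + 2 * (NNReal.sqrt (u + v + w) * NNReal.sqrt u) := by ring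
    _ ≤ u + v + (u + w) + 2 * (NNReal.sqrt (u + v) * NNReal.sqrt (u + w)) := by gcongr
    _ = _ := by ring

lemma sqrt_add_add_add_two_mul_sqrt_le (s t a b : ℝ≥0) :
    NNReal.sqrt (s + t + a + b) + 2 * NNReal.sqrt t
      ≤ NNReal.sqrt (s + t) + NNReal.sqrt (t + a) + NNReal.sqrt (t + b) := by
  have h₁ := sqrt_add_add_add_sqrt_le t s (a + b)
  have h₂ := sqrt_add_add_add_sqrt_le t a b
  rw [show t + s + (a + b) = s + t + a + b by ring, add_comm t s, ← add_assoc t a b] at h₁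
  rw [← NNReal.coe_le_coe] at h₁ h₂ ⊢
  push_cast at h₁ h₂ ⊢
  linarith

section

variable {Ω : Type*} [MeasurableSpace Ω] (μ : Measure Ω) [IsProbabilityMeasure μ]

instance (N : ℕ) : IsProbabilityMeasure (piMeasure μ N) := by
  unfold piMeasure; infer_instance

@[fun_prop]
lemma Measurable.fin_cons {α : Type*} [MeasurableSpace α] {N : ℕ} {f : α → Ω}
    {g : α → Fin N → Ω} (hf : Measurable f) (hg : Measurable g) :
    Measurable fun p => (Fin.cons (f p) (g p) : Fin (N + 1) → Ω) := by
  refine measurable_pi_lambda _ fun i => ?_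
  refine Fin.cases ?_ (fun j => ?_) i
  · simpa using hf
  · simp only [Fin.cons_succ]
    fun_prop

lemma lintegral_piMeasure_succ {N : ℕ} {h : (Fin (N + 1) → Ω) → ℝ≥0∞} (hh : Measurable h) :
    ∫⁻ x, h x ∂piMeasure μ (N + 1)
      = ∫⁻ a, ∫⁻ x, h (Fin.cons a x) ∂piMeasure μ N ∂μ := by
  have e := (measurePreserving_piFinSuccAbove (fun _ : Fin (N + 1) => μ) 0).symm
  rw [piMeasure, ← e.lintegral_comp hh, lintegral_prod _ (by fun_prop)]
  refine lintegral_congr fun a => lintegral_congr fun x => congrArg h ?_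
  exact Fin.insertNth_zero' a x

lemma lintegral_lintegral_piMeasure_succ {N : ℕ}
    {h : (Fin (N + 1) → Ω) × (Fin (N + 1) → Ω) → ℝ≥0∞} (hh : Measurable h) :
    ∫⁻ x, ∫⁻ y, h (x, y) ∂piMeasure μ (N + 1) ∂piMeasure μ (N + 1)
      = ∫⁻ a, ∫⁻ b, ∫⁻ x, ∫⁻ y, h (Fin.cons a x, Fin.cons b y)
          ∂piMeasure μ N ∂piMeasure μ N ∂μ ∂μ := by
  rw [lintegral_piMeasure_succ μ hh.lintegral_prod_right']
  refine lintegral_congr fun a => ?_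
  have hm : Measurable fun p : ((Fin N → Ω) × Ω) × (Fin N → Ω) =>
      h (Fin.cons a p.1.1, Fin.cons p.1.2 p.2) := by fun_prop
  rw [← lintegral_lintegral_swap (f := fun x b => ∫⁻ y, h (Fin.cons a x, Fin.cons b y)
    ∂piMeasure μ N) hm.lintegral_prod_right'.aemeasurable]
  refine lintegral_congr fun x => ?_
  exact lintegral_piMeasure_succ μ (hh.comp measurable_prodMk_left)

/-- Decoupling for tangent sequences: conditionally on the first `k` coordinates of `x` and `y`, the
variables `G k (x, y) (x k)` and `G k (x, y) (y k)` have the same law. -/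
lemma lintegral_sqrt_tangent_add_le (N : ℕ)
    (G : Fin N → (Fin N → Ω) × (Fin N → Ω) → Ω → ℝ≥0)
    (hG : ∀ k, Measurable (Function.uncurry (G k)))
    (hpast : ∀ k (p q : (Fin N → Ω) × (Fin N → Ω)),
      (∀ j < k, p.1 j = q.1 j ∧ p.2 j = q.2 j) → G k p = G k q)
    (s t : ℝ≥0) :
    ∫⁻ x, ∫⁻ y, (NNReal.sqrt
        (s + t + ∑ k, G k (x, y) (x k) + ∑ k, G k (x, y) (y k)) : ℝ≥0∞)
          ∂piMeasure μ N ∂piMeasure μ N + 2 * NNReal.sqrt t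
      ≤ 2 * ∫⁻ x, ∫⁻ y, (NNReal.sqrt (t + ∑ k, G k (x, y) (y k)) : ℝ≥0∞)
          ∂piMeasure μ N ∂piMeasure μ N + NNReal.sqrt (s + t) := by
  induction N generalizing s t with
  | zero => simp [add_comm]
  | succ N ih =>
    have hsqrt : Measurable NNReal.sqrt := NNReal.continuous_sqrt.measurable
    have hx : ∀ k, Measurable fun p : (Fin (N + 1) → Ω) × (Fin (N + 1) → Ω) =>
        G k p (p.1 k) := fun k =>
      (hG k).comp (measurable_id.prodMk ((measurable_pi_apply k).comp measurable_fst))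
    have hy : ∀ k, Measurable fun p : (Fin (N + 1) → Ω) × (Fin (N + 1) → Ω) =>
        G k p (p.2 k) := fun k =>
      (hG k).comp (measurable_id.prodMk ((measurable_pi_apply k).comp measurable_snd))
    have hL : Measurable fun p : (Fin (N + 1) → Ω) × (Fin (N + 1) → Ω) =>
        (NNReal.sqrt (s + t + ∑ k, G k p (p.1 k) + ∑ k, G k p (p.2 k)) : ℝ≥0∞) := by
      fun_prop
    have hR : Measurable fun p : (Fin (N + 1) → Ω) × (Fin (N + 1) → Ω) =>
        (NNReal.sqrt (t + ∑ k, G k p (p.2 k)) : ℝ≥0∞) := by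
      fun_prop
    rw [lintegral_lintegral_piMeasure_succ μ hL, lintegral_lintegral_piMeasure_succ μ hR]
    obtain ⟨ω₀⟩ : Nonempty Ω := nonempty_of_isProbabilityMeasure μ
    set g : Ω → ℝ≥0 := G 0 (fun _ => ω₀, fun _ => ω₀)
    have hg0 : ∀ p, G 0 p = g := fun p => hpast 0 _ _ fun j hj => absurd hj (Fin.not_lt_zero j)
    have hgm : Measurable g := (hG 0).comp measurable_prodMk_left
    simp only [Fin.sum_univ_succ, hg0, Fin.cons_zero, Fin.cons_succ]
    have hgs : Measurable fun b => (NNReal.sqrt (t + g b) : ℝ≥0∞) := by fun_prop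
    have hgst : Measurable fun r : Ω × Ω =>
        (NNReal.sqrt (s + g r.1 + (t + g r.2)) : ℝ≥0∞) := by fun_prop
    set J := ∫⁻ b, (NNReal.sqrt (t + g b) : ℝ≥0∞) ∂μ with hJ
    have past := fun a b : Ω => ih
      (fun k p => G k.succ (Fin.cons a p.1, Fin.cons b p.2))
      (fun k => (hG k.succ).comp (g := Function.uncurry (G k.succ))
        (f := fun q : ((Fin N → Ω) × (Fin N → Ω)) × Ω =>
          (((Fin.cons a q.1.1 : Fin (N + 1) → Ω), (Fin.cons b q.1.2 : Fin (N + 1) → Ω)), q.2))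
        (by fun_prop))
      (fun k p q h => hpast _ _ _ fun j hj => by
        refine Fin.cases (fun _ => by simp) (fun i hi => ?_) j hj
        simpa using h i (Fin.succ_lt_succ_iff.1 hi))
      (s + g a) (t + g b)
    set Φ : Ω → Ω → ℝ≥0∞ := fun a b => ∫⁻ x, ∫⁻ y, (NNReal.sqrt (s + t +
      (g a + ∑ k : Fin N, G k.succ (Fin.cons a x, Fin.cons b y) (x k)) +
      (g b + ∑ k : Fin N, G k.succ (Fin.cons a x, Fin.cons b y) (y k))) : ℝ≥0∞)
      ∂piMeasure μ N ∂piMeasure μ N with hΦ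
    set Ψ : Ω → Ω → ℝ≥0∞ := fun a b => ∫⁻ x, ∫⁻ y, (NNReal.sqrt (t +
      (g b + ∑ k : Fin N, G k.succ (Fin.cons a x, Fin.cons b y) (y k))) : ℝ≥0∞)
      ∂piMeasure μ N ∂piMeasure μ N with hΨ
    have hstep : ∀ a b, Φ a b + 2 * NNReal.sqrt (t + g b)
        ≤ 2 * Ψ a b + NNReal.sqrt (s + g a + (t + g b)) := by
      intro a b
      refine le_trans (le_of_eq ?_) ((past a b).trans (le_of_eq ?_))
      · simp only [hΦ]
        congr! 7
        ring
      · simp only [hΨ, add_assoc]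
    have hmono : ∫⁻ a, ∫⁻ b, Φ a b ∂μ ∂μ + 2 * J ≤ 2 * ∫⁻ a, ∫⁻ b, Ψ a b ∂μ ∂μ
        + ∫⁻ a, ∫⁻ b, (NNReal.sqrt (s + g a + (t + g b)) : ℝ≥0∞) ∂μ ∂μ := by
      have h := lintegral_mono (μ := μ) fun a => lintegral_mono (μ := μ) fun b => hstep a b
      have hl : ∀ a, ∫⁻ b, (Φ a b + 2 * NNReal.sqrt (t + g b)) ∂μ = ∫⁻ b, Φ a b ∂μ + 2 * J := by
        intro a
        rw [lintegral_add_right _ (hgs.const_mul 2), lintegral_const_mul 2 hgs]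
      have hr : ∀ a, ∫⁻ b, (2 * Ψ a b + NNReal.sqrt (s + g a + (t + g b))) ∂μ
          = 2 * ∫⁻ b, Ψ a b ∂μ + ∫⁻ b, (NNReal.sqrt (s + g a + (t + g b)) : ℝ≥0∞) ∂μ := by
        intro a
        have hm : Measurable fun b => (NNReal.sqrt (s + g a + (t + g b)) : ℝ≥0∞) := by fun_prop
        rw [lintegral_add_right _ hm,
          lintegral_const_mul' 2 _ (by simp)]
      simp only [hl, hr] at h
      rwa [lintegral_add_right _ measurable_const, lintegral_const, measure_univ, mul_one,
        lintegral_add_right _ hgst.lintegral_prod_right', lintegral_const_mul' 2 _ (by simp)] at h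
    have hfirst : ∫⁻ a, ∫⁻ b, (NNReal.sqrt (s + g a + (t + g b)) : ℝ≥0∞) ∂μ ∂μ
        + 2 * NNReal.sqrt t ≤ NNReal.sqrt (s + t) + 2 * J := by
      calc _ = ∫⁻ a, ∫⁻ b, ((NNReal.sqrt (s + g a + (t + g b)) : ℝ≥0∞)
              + 2 * NNReal.sqrt t) ∂μ ∂μ := by
            simp [lintegral_add_right _ measurable_const]
        _ ≤ ∫⁻ a, ∫⁻ b, ((NNReal.sqrt (s + t) : ℝ≥0∞) + NNReal.sqrt (t + g a)
              + NNReal.sqrt (t + g b)) ∂μ ∂μ := by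
            refine lintegral_mono fun a => lintegral_mono fun b => ?_
            have := sqrt_add_add_add_two_mul_sqrt_le s t (g a) (g b)
            rw [show s + t + g a + g b = s + g a + (t + g b) by ring] at this
            simpa using ENNReal.coe_le_coe.2 this
        _ = NNReal.sqrt (s + t) + 2 * J := by
            simp only [lintegral_add_right _ hgs, lintegral_const, measure_univ, mul_one, ← hJ]
            rw [lintegral_add_right _ measurable_const, lintegral_add_right _ hgs]
            simp [← hJ, two_mul, add_assoc]
    have hJle : J ≤ ∫⁻ a, ∫⁻ b, Ψ a b ∂μ ∂μ := by
      calc J = ∫⁻ _, ∫⁻ b, ∫⁻ _, ∫⁻ _, (NNReal.sqrt (t + g b) : ℝ≥0∞)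
            ∂piMeasure μ N ∂piMeasure μ N ∂μ ∂μ := by simp [← hJ]
        _ ≤ _ := by
          refine lintegral_mono fun a => lintegral_mono fun b => lintegral_mono fun x =>
            lintegral_mono fun y => ?_
          refine ENNReal.coe_le_coe.2 (NNReal.sqrt_le_sqrt.2 ?_)
          gcongr
          exact le_self_add
    by_cases hJtop : J = ∞
    · rw [hJtop, top_le_iff] at hJle
      rw [hJle]
      simp
    · have hJ2 : 2 * J ≠ ∞ := ENNReal.mul_ne_top (by simp) hJtop
      refine (ENNReal.add_le_add_iff_right hJ2).1 ?_
      calc _ = (∫⁻ a, ∫⁻ b, Φ a b ∂μ ∂μ + 2 * J) + 2 * NNReal.sqrt t := by ring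
        _ ≤ _ := by grw [hmono]
        _ = 2 * ∫⁻ a, ∫⁻ b, Ψ a b ∂μ ∂μ + (∫⁻ a, ∫⁻ b,
            (NNReal.sqrt (s + g a + (t + g b)) : ℝ≥0∞) ∂μ ∂μ + 2 * NNReal.sqrt t) := by ring
        _ ≤ _ := by grw [hfirst]
        _ = _ := by ring

lemma lintegral_sqrt_tangent_le (N : ℕ)
    (G : Fin N → (Fin N → Ω) × (Fin N → Ω) → Ω → ℝ≥0)
    (hG : ∀ k, Measurable (Function.uncurry (G k)))
    (hpast : ∀ k (p q : (Fin N → Ω) × (Fin N → Ω)),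
      (∀ j < k, p.1 j = q.1 j ∧ p.2 j = q.2 j) → G k p = G k q) :
    ∫⁻ x, ∫⁻ y, (NNReal.sqrt (∑ k, G k (x, y) (x k)) : ℝ≥0∞) ∂piMeasure μ N ∂piMeasure μ N
      ≤ 2 * ∫⁻ x, ∫⁻ y, (NNReal.sqrt (∑ k, G k (x, y) (y k)) : ℝ≥0∞)
          ∂piMeasure μ N ∂piMeasure μ N := by
  have h := lintegral_sqrt_tangent_add_le μ N G hG hpast 0 0
  simp only [zero_add, NNReal.sqrt_zero, ENNReal.coe_zero, mul_zero, add_zero] at h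
  refine le_trans (lintegral_mono fun x => lintegral_mono fun y => ?_) h
  exact ENNReal.coe_le_coe.2 (NNReal.sqrt_le_sqrt.2 le_self_add)

lemma lintegral_sqrt_tangent_swap_le (N : ℕ)
    (G : Fin N → (Fin N → Ω) × (Fin N → Ω) → Ω → ℝ≥0)
    (hG : ∀ k, Measurable (Function.uncurry (G k)))
    (hpast : ∀ k (p q : (Fin N → Ω) × (Fin N → Ω)),
      (∀ j < k, p.1 j = q.1 j ∧ p.2 j = q.2 j) → G k p = G k q) :
    ∫⁻ x, ∫⁻ y, (NNReal.sqrt (∑ k, G k (x, y) (y k)) : ℝ≥0∞) ∂piMeasure μ N ∂piMeasure μ N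
      ≤ 2 * ∫⁻ x, ∫⁻ y, (NNReal.sqrt (∑ k, G k (x, y) (x k)) : ℝ≥0∞)
          ∂piMeasure μ N ∂piMeasure μ N := by
  have hsqrt : Measurable NNReal.sqrt := NNReal.continuous_sqrt.measurable
  have hGx : ∀ k, Measurable fun p : (Fin N → Ω) × (Fin N → Ω) => G k p (p.1 k) := fun k =>
    (hG k).comp (measurable_id.prodMk ((measurable_pi_apply k).comp measurable_fst))
  have hGy : ∀ k, Measurable fun p : (Fin N → Ω) × (Fin N → Ω) => G k p (p.2 k) := fun k =>
    (hG k).comp (measurable_id.prodMk ((measurable_pi_apply k).comp measurable_snd))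
  have hx : Measurable fun p : (Fin N → Ω) × (Fin N → Ω) =>
      (NNReal.sqrt (∑ k, G k p (p.1 k)) : ℝ≥0∞) := by fun_prop
  have hy : Measurable fun p : (Fin N → Ω) × (Fin N → Ω) =>
      (NNReal.sqrt (∑ k, G k p (p.2 k)) : ℝ≥0∞) := by fun_prop
  rw [lintegral_lintegral_swap hy.aemeasurable,
    lintegral_lintegral_swap (f := fun x y => (NNReal.sqrt (∑ k, G k (x, y) (x k)) : ℝ≥0∞))
      hx.aemeasurable]
  exact lintegral_sqrt_tangent_le μ N (fun k p => G k p.swap)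
    (fun k => (hG k).comp (measurable_swap.prodMap measurable_id))
    (fun k p q h => hpast k _ _ fun j hj => (h j hj).symm)

end

lemma ofReal_sqrt_sum_sq {ι : Type*} (s : Finset ι) (u : ι → ℝ) :
    ENNReal.ofReal (Real.sqrt (∑ i ∈ s, u i ^ 2)) = NNReal.sqrt (∑ i ∈ s, ‖u i‖₊ ^ 2) := by
  rw [← ENNReal.ofReal_coe_nnreal]
  simp

lemma ite_castLE_eq {Ω : Type*} {N : ℕ} (x y : Fin N → Ω) (k : Fin N) :
    (fun j : Fin ((k : ℕ) + 1) => if (j : ℕ) < (k : ℕ) then x (Fin.castLE k.isLt j)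
        else y (Fin.castLE k.isLt j))
      = fun j : Fin ((k : ℕ) + 1) =>
          if (j : ℕ) < (k : ℕ) then x (Fin.castLE k.isLt j) else y k := by
  funext j
  split_ifs with hj
  · rfl
  · congr 1
    ext
    simp only [Fin.val_castLE]
    omega

/-- The square of `f k` with `x` in the past coordinates and `z` in the present one; the second
component of the pair `p = (x, y)` is ignored. -/
noncomputable def decoupledSq {Ω : Type*} {N : ℕ} (f : (k : Fin N) → (Fin ((k : ℕ) + 1) → Ω) → ℝ)
    (k : Fin N) (p : (Fin N → Ω) × (Fin N → Ω)) (z : Ω) : ℝ≥0 :=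
  ‖f k (fun j => if (j : ℕ) < (k : ℕ) then p.1 (Fin.castLE k.isLt j) else z)‖₊ ^ 2

lemma measurable_uncurry_decoupledSq {Ω : Type*} [MeasurableSpace Ω] {N : ℕ}
    (f : (k : Fin N) → (Fin ((k : ℕ) + 1) → Ω) → ℝ) (hf : ∀ k, Measurable (f k)) (k : Fin N) :
    Measurable (Function.uncurry (decoupledSq f k)) := by
  have h : Measurable fun q : ((Fin N → Ω) × (Fin N → Ω)) × Ω => fun j : Fin ((k : ℕ) + 1) =>
      if (j : ℕ) < (k : ℕ) then q.1.1 (Fin.castLE k.isLt j) else q.2 := by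
    refine measurable_pi_lambda _ fun j => ?_
    split_ifs <;> fun_prop
  exact ((hf k).comp h).nnnorm.pow_const 2

lemma decoupledSq_congr {Ω : Type*} {N : ℕ} (f : (k : Fin N) → (Fin ((k : ℕ) + 1) → Ω) → ℝ)
    (k : Fin N) {p q : (Fin N → Ω) × (Fin N → Ω)} (h : ∀ j < k, p.1 j = q.1 j) :
    decoupledSq f k p = decoupledSq f k q := by
  funext z
  unfold decoupledSq
  congr! 5 with j hj
  exact h _ hj

lemma ofReal_sqrt_coupled {Ω : Type*} {N : ℕ} (f : (k : Fin N) → (Fin ((k : ℕ) + 1) → Ω) → ℝ)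
    (x y : Fin N → Ω) :
    ENNReal.ofReal (Real.sqrt (∑ k : Fin N, (f k (fun j => x (Fin.castLE k.isLt j))) ^ 2))
      = (NNReal.sqrt (∑ k, decoupledSq f k (x, y) (x k)) : ℝ≥0∞) := by
  have hx := fun k : Fin N => ite_castLE_eq x x k
  simp only [ite_self] at hx
  simp only [ofReal_sqrt_sum_sq, decoupledSq, hx]

lemma ofReal_sqrt_decoupled {Ω : Type*} {N : ℕ} (f : (k : Fin N) → (Fin ((k : ℕ) + 1) → Ω) → ℝ)
    (x y : Fin N → Ω) :
    ENNReal.ofReal (Real.sqrt (∑ k : Fin N,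
      (f k (fun j => if (j : ℕ) < (k : ℕ) then x (Fin.castLE k.isLt j)
        else y (Fin.castLE k.isLt j))) ^ 2))
      = (NNReal.sqrt (∑ k, decoupledSq f k (x, y) (y k)) : ℝ≥0∞) := by
  simp only [ofReal_sqrt_sum_sq, decoupledSq, ite_castLE_eq]

/-- Zinn's decoupling inequality: with absolute constants `c, C > 0`,
for measurable `f_k : Ω^k → ℝ`,
`∫ √(Σ_k |f_k(x₁,…,x_k)|²) dx ≍ ∫∫ √(Σ_k |f_k(x₁,…,x_{k−1},y_k)|²) dx dy`. -/
theorem zinn_decoupling :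
    ∃ c C : ℝ, 0 < c ∧ 0 < C ∧
      ∀ (Ω : Type) [MeasurableSpace Ω] (μ : Measure Ω) [IsProbabilityMeasure μ]
        (N : ℕ) (f : (k : Fin N) → (Fin ((k : ℕ) + 1) → Ω) → ℝ),
        (∀ k, Measurable (f k)) →
        (ENNReal.ofReal c *
            ∫⁻ x, ∫⁻ y, ENNReal.ofReal (Real.sqrt (∑ k : Fin N,
              (f k (fun j => if (j : ℕ) < (k : ℕ) then x (Fin.castLE k.isLt j)
                else y (Fin.castLE k.isLt j))) ^ 2)) ∂(piMeasure μ N) ∂(piMeasure μ N)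
          ≤ ∫⁻ x, ENNReal.ofReal (Real.sqrt (∑ k : Fin N,
              (f k (fun j => x (Fin.castLE k.isLt j))) ^ 2)) ∂(piMeasure μ N)) ∧
        (∫⁻ x, ENNReal.ofReal (Real.sqrt (∑ k : Fin N,
              (f k (fun j => x (Fin.castLE k.isLt j))) ^ 2)) ∂(piMeasure μ N)
          ≤ ENNReal.ofReal C *
            ∫⁻ x, ∫⁻ y, ENNReal.ofReal (Real.sqrt (∑ k : Fin N,
              (f k (fun j => if (j : ℕ) < (k : ℕ) then x (Fin.castLE k.isLt j)
                else y (Fin.castLE k.isLt j))) ^ 2)) ∂(piMeasure μ N) ∂(piMeasure μ N)) := by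
  refine ⟨1 / 2, 2, by norm_num, by norm_num, ?_⟩
  intro Ω _ μ _ N f hf
  have hcoupled : ∀ x, ENNReal.ofReal (Real.sqrt (∑ k : Fin N,
      (f k (fun j => x (Fin.castLE k.isLt j))) ^ 2)) = ∫⁻ y,
        (NNReal.sqrt (∑ k, decoupledSq f k (x, y) (x k)) : ℝ≥0∞) ∂piMeasure μ N := by
    intro x
    simp only [← ofReal_sqrt_coupled, lintegral_const, measure_univ, mul_one]
  have hpast : ∀ k (p q : (Fin N → Ω) × (Fin N → Ω)),
      (∀ j < k, p.1 j = q.1 j ∧ p.2 j = q.2 j) → decoupledSq f k p = decoupledSq f k q :=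
    fun k p q h => decoupledSq_congr f k fun j hj => (h j hj).1
  have hG := measurable_uncurry_decoupledSq f hf
  simp only [hcoupled, ofReal_sqrt_decoupled]
  constructor
  · refine (mul_le_mul_right (lintegral_sqrt_tangent_swap_le μ N _ hG hpast) _).trans
      (le_of_eq ?_)
    rw [← mul_assoc, ← ENNReal.ofReal_ofNat 2, ← ENNReal.ofReal_mul (by norm_num)]
    norm_num
  · rw [ENNReal.ofReal_ofNat]
    exact lintegral_sqrt_tangent_le μ N _ hG hpast
end

section
/- There is an absolute constant C such that the following holds. Let (S₁, μ₁) and (S₂, μ₂) be σ-finite measure spaces, I₁ and I₂ countable index sets, X₁ a closed linear subspace of L¹(S₁, ℓ²(I₁)), and T : X₁ → L¹(S₂, ℓ²(I₂)) a bounded linear operator. Then for any finite family f₁,…,f_J ∈ X₁, ∫_{S₂} √(Σ_{j=1}^J ‖(T f_j)(s)‖²_{ℓ²(I₂)}) dμ₂(s) ≤ C ‖T‖ ∫_{S₁} √(Σ_{j=1}^J ‖f_j(s)‖²_{ℓ²(I₁)}) dμ₁(s). (Equivalently, T ⊗ id_B is bounded with norm ≲ ‖T‖ for every Hilbert space B.)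 -/
open MeasureTheory
open scoped NNReal ENNReal

section Rademacher

variable {H : Type*} [NormedAddCommGroup H] [InnerProductSpace ℂ H]

/-- The complex sign `±1` encoded by a Boolean. -/
def boolSign (b : Bool) : ℂ := if b then 1 else -1

/-- The signed sum `∑ ±x_j`, with signs given by `ε`. -/
def signedSum {E : Type*} [AddCommGroup E] [Module ℂ E] {J : ℕ} (x : Fin J → E)
    (ε : Fin J → Bool) : E :=
  ∑ j, boolSign (ε j) • x j

theorem sum_boolFun_succ {M : Type*} [AddCommMonoid M] {J : ℕ} (F : (Fin (J + 1) → Bool) → M) :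
    ∑ ε, F ε = ∑ ε : Fin J → Bool, (F (Fin.cons true ε) + F (Fin.cons false ε)) := by
  rw [← (Fin.consEquiv (fun _ : Fin (J + 1) => Bool)).sum_comp, Fintype.sum_prod_type]
  simp [Fin.consEquiv, Finset.sum_add_distrib]

theorem signedSum_cons_true {J : ℕ} (x : Fin (J + 1) → H) (ε : Fin J → Bool) :
    signedSum x (Fin.cons true ε) = signedSum (fun j => x j.succ) ε + x 0 := by
  simp [signedSum, Fin.sum_univ_succ, boolSign, add_comm]

theorem signedSum_cons_false {J : ℕ} (x : Fin (J + 1) → H) (ε : Fin J → Bool) :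
    signedSum x (Fin.cons false ε) = signedSum (fun j => x j.succ) ε - x 0 := by
  simp [signedSum, Fin.sum_univ_succ, boolSign]
  abel

theorem sum_norm_signedSum_sq {J : ℕ} (x : Fin J → H) :
    ∑ ε, ‖signedSum x ε‖ ^ 2 = 2 ^ J * ∑ j, ‖x j‖ ^ 2 := by
  induction J with
  | zero => simp [signedSum]
  | succ J ih =>
    have parallelogram (a b : H) : ‖a + b‖ ^ 2 + ‖a - b‖ ^ 2 = 2 * ‖a‖ ^ 2 + 2 * ‖b‖ ^ 2 := by
      have := parallelogram_law_with_norm ℂ a b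
      nlinarith
    rw [sum_boolFun_succ]
    simp only [signedSum_cons_true, signedSum_cons_false, parallelogram]
    rw [Finset.sum_add_distrib, ← Finset.mul_sum, ih, Fin.sum_univ_succ]
    simp
    ring

theorem norm_add_pow_four_add_norm_sub_pow_four_le (a b : H) :
    ‖a + b‖ ^ 4 + ‖a - b‖ ^ 4 ≤ 2 * ‖a‖ ^ 4 + 12 * ‖b‖ ^ 2 * ‖a‖ ^ 2 + 2 * ‖b‖ ^ 4 := by
  have hadd := norm_add_sq (𝕜 := ℂ) a b
  have hsub := norm_sub_sq (𝕜 := ℂ) a b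
  have hinner : (RCLike.re (inner ℂ a b)) ^ 2 ≤ (‖a‖ * ‖b‖) ^ 2 := by
    refine sq_le_sq' ?_ (re_inner_le_norm a b)
    exact neg_le_of_abs_le ((RCLike.abs_re_le_norm _).trans (norm_inner_le_norm a b))
  rw [show ‖a + b‖ ^ 4 = (‖a + b‖ ^ 2) ^ 2 by ring,
    show ‖a - b‖ ^ 4 = (‖a - b‖ ^ 2) ^ 2 by ring, hadd, hsub]
  nlinarith

theorem sum_norm_signedSum_pow_four_le {J : ℕ} (x : Fin J → H) :
    ∑ ε, ‖signedSum x ε‖ ^ 4 ≤ 2 ^ J * (3 * (∑ j, ‖x j‖ ^ 2) ^ 2) := by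
  induction J with
  | zero => simp [signedSum]
  | succ J ih =>
    rw [sum_boolFun_succ]
    simp only [signedSum_cons_true, signedSum_cons_false]
    refine (Finset.sum_le_sum fun ε _ =>
      norm_add_pow_four_add_norm_sub_pow_four_le _ (x 0)).trans ?_
    rw [Finset.sum_add_distrib, Finset.sum_add_distrib, ← Finset.mul_sum, ← Finset.mul_sum,
      sum_norm_signedSum_sq, Fin.sum_univ_succ]
    have h := ih (fun j => x j.succ)
    have hx : 0 ≤ (2 : ℝ) ^ J * ‖x 0‖ ^ 4 := by positivity
    simp only [Finset.sum_const, Finset.card_univ, Fintype.card_pi, Fintype.card_bool,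
      Finset.prod_const, Fintype.card_fin, nsmul_eq_mul, Nat.cast_pow, Nat.cast_ofNat, pow_succ _ J]
    nlinarith

/-- The upper Khintchine inequality for the first moment. -/
theorem sum_norm_signedSum_le {J : ℕ} (x : Fin J → H) :
    ∑ ε, ‖signedSum x ε‖ ≤ 2 ^ J * √(∑ j, ‖x j‖ ^ 2) := by
  have hcs := sq_sum_le_card_mul_sum_sq (s := Finset.univ) (f := fun ε => ‖signedSum x ε‖)
  rw [sum_norm_signedSum_sq] at hcs
  have hcard : ((Finset.univ : Finset (Fin J → Bool)).card : ℝ) = 2 ^ J := by simp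
  rw [hcard] at hcs
  refine (sq_le_sq₀ (by positivity) (by positivity)).mp ?_
  rw [mul_pow, Real.sq_sqrt (by positivity)]
  linarith

/-- The lower Khintchine inequality for the first moment. -/
theorem sqrt_sum_sq_le_sum_norm_signedSum {J : ℕ} (x : Fin J → H) :
    2 ^ J * √(∑ j, ‖x j‖ ^ 2) ≤ 2 * ∑ ε, ‖signedSum x ε‖ := by
  set σ := √(∑ j, ‖x j‖ ^ 2)
  have hσ_sq : ∑ j, ‖x j‖ ^ 2 = σ ^ 2 := (Real.sq_sqrt (by positivity)).symm
  have hσ_nonneg : 0 ≤ σ := Real.sqrt_nonneg _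
  rcases hσ_nonneg.eq_or_lt with h0 | hpos
  · rw [← h0, mul_zero]
    positivity
  have hpoint (t : ℝ) (ht : 0 ≤ t) : σ ^ 2 * t ^ 2 - 4 / 27 * t ^ 4 ≤ σ ^ 3 * t := by
    have : 0 ≤ t * ((t - 3 / 2 * σ) ^ 2 * (t + 3 * σ)) := by positivity
    nlinarith
  have hsum := Finset.sum_le_sum fun ε (_ : ε ∈ Finset.univ) =>
    hpoint ‖signedSum x ε‖ (norm_nonneg _)
  rw [Finset.sum_sub_distrib, ← Finset.mul_sum, ← Finset.mul_sum, ← Finset.mul_sum,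
    sum_norm_signedSum_sq, hσ_sq] at hsum
  have hfour := sum_norm_signedSum_pow_four_le x
  rw [hσ_sq] at hfour
  have hpow : 0 ≤ (2 : ℝ) ^ J * σ ^ 4 := by positivity
  refine le_of_mul_le_mul_left ?_ (pow_pos hpos 3)
  nlinarith

end Rademacher

section SignedLp

variable {S E : Type*} [MeasurableSpace S] {μ : Measure S}
  [NormedAddCommGroup E]

theorem integrable_sqrt_sum_norm_sq {J : ℕ} (g : Fin J → Lp E 1 μ) :
    Integrable (fun s => √(∑ j, ‖g j s‖ ^ 2)) μ := by
  have hsum : Integrable (fun s => ∑ j, ‖g j s‖) μ :=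
    integrable_finsetSum _ fun j _ => (L1.integrable_coeFn (g j)).norm
  refine hsum.mono' ?_ (Filter.Eventually.of_forall fun s => ?_)
  · refine Real.continuous_sqrt.comp_aestronglyMeasurable ?_
    exact Finset.aestronglyMeasurable_fun_sum _ fun j _ =>
      (L1.integrable_coeFn (g j)).aestronglyMeasurable.norm.pow 2
  · rw [Real.norm_of_nonneg (Real.sqrt_nonneg _)]
    exact Real.sqrt_le_iff.mpr ⟨by positivity,
      Finset.sum_sq_le_sq_sum_of_nonneg fun j _ => norm_nonneg _⟩

variable [NormedSpace ℂ E]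

theorem coeFn_signedSum {J : ℕ} (g : Fin J → Lp E 1 μ) (ε : Fin J → Bool) :
    (signedSum g ε : Lp E 1 μ) =ᵐ[μ] fun s => signedSum (fun j => g j s) ε := by
  have hsum (t : Finset (Fin J)) : (∑ j ∈ t, boolSign (ε j) • g j : Lp E 1 μ) =ᵐ[μ]
      fun s => ∑ j ∈ t, boolSign (ε j) • g j s := by
    induction t using Finset.induction_on with
    | empty =>
      filter_upwards [Lp.coeFn_zero E 1 μ] with s hs
      simpa using hs
    | insert a t ha ih =>
      rw [Finset.sum_insert ha]
      filter_upwards [ih, Lp.coeFn_add (boolSign (ε a) • g a) (∑ j ∈ t, boolSign (ε j) • g j),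
        Lp.coeFn_smul (boolSign (ε a)) (g a)] with s h₁ h₂ h₃
      rw [h₂, Pi.add_apply, h₁, h₃, Pi.smul_apply, Finset.sum_insert ha]
  exact hsum Finset.univ

theorem integrable_norm_signedSum {J : ℕ} (g : Fin J → Lp E 1 μ) (ε : Fin J → Bool) :
    Integrable (fun s => ‖signedSum (fun j => g j s) ε‖) μ :=
  ((L1.integrable_coeFn (signedSum g ε)).congr (coeFn_signedSum g ε)).norm

theorem integral_norm_signedSum {J : ℕ} (g : Fin J → Lp E 1 μ) (ε : Fin J → Bool) :
    ∫ s, ‖signedSum (fun j => g j s) ε‖ ∂μ = ‖signedSum g ε‖ := by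
  rw [L1.norm_eq_integral_norm]
  refine integral_congr_ae ?_
  filter_upwards [coeFn_signedSum g ε] with s hs
  rw [hs]

end SignedLp

section SquareFunction

variable {S H : Type*} [MeasurableSpace S] {μ : Measure S}
  [NormedAddCommGroup H] [InnerProductSpace ℂ H]

theorem sum_norm_signedSum_Lp_le {J : ℕ} (g : Fin J → Lp H 1 μ) :
    ∑ ε, ‖signedSum g ε‖ ≤ 2 ^ J * ∫ s, √(∑ j, ‖g j s‖ ^ 2) ∂μ := by
  simp only [← integral_norm_signedSum]
  rw [← integral_finsetSum _ fun ε _ => integrable_norm_signedSum g ε, ← integral_const_mul]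
  exact integral_mono (integrable_finsetSum _ fun ε _ => integrable_norm_signedSum g ε)
    ((integrable_sqrt_sum_norm_sq g).const_mul _) fun s => sum_norm_signedSum_le fun j => g j s

theorem integral_sqrt_sum_norm_sq_le {J : ℕ} (g : Fin J → Lp H 1 μ) :
    2 ^ J * ∫ s, √(∑ j, ‖g j s‖ ^ 2) ∂μ ≤ 2 * ∑ ε, ‖signedSum g ε‖ := by
  simp only [← integral_norm_signedSum]
  rw [← integral_finsetSum _ fun ε _ => integrable_norm_signedSum g ε, ← integral_const_mul,
    ← integral_const_mul]
  exact integral_mono ((integrable_sqrt_sum_norm_sq g).const_mul _)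
    ((integrable_finsetSum _ fun ε _ => integrable_norm_signedSum g ε).const_mul _)
    fun s => sqrt_sum_sq_le_sum_norm_signedSum fun j => g j s

/-- Bounded operators on subspaces of Hilbert-valued `L¹` extend to square functions. -/
theorem integral_sqrt_sum_norm_sq_map_le {S' H' : Type*} [MeasurableSpace S'] {ν : Measure S'}
    [NormedAddCommGroup H'] [InnerProductSpace ℂ H'] (X : Submodule ℂ (Lp H 1 μ))
    (T : X →L[ℂ] Lp H' 1 ν) {J : ℕ} (f : Fin J → X) :
    ∫ s, √(∑ j, ‖T (f j) s‖ ^ 2) ∂ν ≤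
      2 * ‖T‖ * ∫ s, √(∑ j, ‖(f j : Lp H 1 μ) s‖ ^ 2) ∂μ := by
  have hT (ε : Fin J → Bool) :
      ‖signedSum (fun j => T (f j)) ε‖ ≤ ‖T‖ * ‖signedSum (fun j => (f j : Lp H 1 μ)) ε‖ := by
    have h := T.le_opNorm (signedSum f ε)
    simpa [signedSum, map_sum] using h
  have hsum := Finset.sum_le_sum fun ε (_ : ε ∈ Finset.univ) => hT ε
  rw [← Finset.mul_sum] at hsum
  have hlower := integral_sqrt_sum_norm_sq_le fun j => T (f j)
  have hupper := mul_le_mul_of_nonneg_left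
    (sum_norm_signedSum_Lp_le fun j => (f j : Lp H 1 μ)) (norm_nonneg T)
  refine le_of_mul_le_mul_left ?_ (by positivity : (0 : ℝ) < 2 ^ J)
  linarith

end SquareFunction

/-- Marcinkiewicz–Zygmund type extension: there is an absolute `C` such
that for σ-finite measure spaces `S₁, S₂`, countable index sets `I₁, I₂`, a closed
subspace `X₁ ⊆ L¹(S₁, ℓ²(I₁))` and a bounded operator `T : X₁ → L¹(S₂, ℓ²(I₂))`, for any
`f₁,…,f_J ∈ X₁`,
`∫ √(Σ_j ‖(T f_j)(s)‖²) dμ₂ ≤ C ‖T‖ ∫ √(Σ_j ‖f_j(s)‖²) dμ₁`. -/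
theorem hilbert_valued_extension :
    ∃ C : ℝ, 0 < C ∧
      ∀ (S₁ S₂ : Type) [MeasurableSpace S₁] [MeasurableSpace S₂]
        (μ₁ : Measure S₁) (μ₂ : Measure S₂) [SigmaFinite μ₁] [SigmaFinite μ₂]
        (I₁ I₂ : Type) [Countable I₁] [Countable I₂]
        (X₁ : Submodule ℂ (Lp (lp (fun _ : I₁ => ℂ) 2) 1 μ₁)),
        IsClosed (X₁ : Set (Lp (lp (fun _ : I₁ => ℂ) 2) 1 μ₁)) →
        ∀ (T : X₁ →L[ℂ] Lp (lp (fun _ : I₂ => ℂ) 2) 1 μ₂) (J : ℕ) (f : Fin J → X₁),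
        ∫ s, Real.sqrt (∑ j : Fin J, ‖(T (f j) : S₂ → lp (fun _ : I₂ => ℂ) 2) s‖ ^ 2) ∂μ₂
          ≤ C * ‖T‖ *
            ∫ s, Real.sqrt (∑ j : Fin J,
              ‖((f j : Lp (lp (fun _ : I₁ => ℂ) 2) 1 μ₁) : S₁ → lp (fun _ : I₁ => ℂ) 2) s‖ ^ 2) ∂μ₁ := by
  exact ⟨2, two_pos, fun _ _ _ _ _ _ _ _ _ _ _ _ X₁ _ T _ f =>
    integral_sqrt_sum_norm_sq_map_le X₁ T f⟩
end
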